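/- arXiv:2605.30253 — 7 statements merged into one kernel-verified Lean document; each statement's English description precedes it below -/
import Mathlib

section
/- One-step contraction of alternating minimization in the first block (Theorem 3, first conclusion). Under the setup in the context, for every x₀ ∈ E with ‖x₀ − x⋆‖ < ε_x, the next alternating-minimization iterate x₁ := xs (ys x₀) satisfies ‖x₁ − x⋆‖ ≤ (L₁₂·L₂₁)/(λ₁₂·λ₂₁) · ‖x₀ − x⋆‖. -/
/-- One-step contraction of alternating minimization in the first block
(Theorem 3, first conclusion). -/
theorem alt_min_one_step_first_block
    {E F : Type*} [NormedAddCommGroup E] [InnerProductSpace ℝ E] [FiniteDimensional ℝ E]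
    [NormedAddCommGroup F] [InnerProductSpace ℝ F] [FiniteDimensional ℝ F]
    (f : E × F → ℝ) (hf : Differentiable ℝ f)
    (xs : F → E) (ys : E → F) (xstar : E) (ystar : F)
    (L12 L21 lam12 lam21 εx εy : ℝ)
    (hL12 : 0 ≤ L12) (hL21 : 0 ≤ L21) (hlam12 : 0 < lam12) (hlam21 : 0 < lam21)
    (hεx : 0 < εx) (hεy : 0 < εy)
    (hball1 : L21 * εx ≤ lam21 * εy) (hball2 : L12 * εy ≤ lam12 * εx)
    (hfoc1 : ∀ y : F, gradient (fun x => f (x, y)) (xs y) = 0)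
    (hfoc2 : ∀ x : E, gradient (fun y => f (x, y)) (ys x) = 0)
    (hfix1 : xs ystar = xstar) (hfix2 : ys xstar = ystar)
    (hcs1 : ∀ x : E, ∀ y : F, ‖y - ystar‖ < εy →
      ‖gradient (fun x' => f (x', y)) x - gradient (fun x' => f (x', ystar)) x‖
        ≤ L12 * ‖y - ystar‖)
    (hcs2 : ∀ y : F, ∀ x : E, ‖x - xstar‖ < εx →
      ‖gradient (fun y' => f (x, y')) y - gradient (fun y' => f (xstar, y')) y‖
        ≤ L21 * ‖x - xstar‖)
    (hqg1 : ∀ x : E, lam12 * ‖x - xstar‖ ≤ ‖gradient (fun x' => f (x', ystar)) x‖)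
    (hqg2 : ∀ y : F, lam21 * ‖y - ystar‖ ≤ ‖gradient (fun y' => f (xstar, y')) y‖)
    (x₀ : E) (hx₀ : ‖x₀ - xstar‖ < εx) :
    ‖xs (ys x₀) - xstar‖ ≤ (L12 * L21) / (lam12 * lam21) * ‖x₀ - xstar‖ := by
  have hy : lam21 * ‖ys x₀ - ystar‖ ≤ L21 * ‖x₀ - xstar‖ := by
    have h := hcs2 (ys x₀) x₀ hx₀
    rw [hfoc2 x₀, zero_sub, norm_neg] at h
    exact (hqg2 _).trans h
  have hy_lt : ‖ys x₀ - ystar‖ < εy := by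
    refine lt_of_mul_lt_mul_left ?_ hlam21.le
    rcases hL21.eq_or_lt with h0 | hpos
    · rw [← h0, zero_mul] at hy
      exact hy.trans_lt (mul_pos hlam21 hεy)
    · exact hy.trans_lt ((mul_lt_mul_of_pos_left hx₀ hpos).trans_le hball1)
  have hx : lam12 * ‖xs (ys x₀) - xstar‖ ≤ L12 * ‖ys x₀ - ystar‖ := by
    have h := hcs1 (xs (ys x₀)) (ys x₀) hy_lt
    rw [hfoc1 (ys x₀), zero_sub, norm_neg] at h
    exact (hqg1 _).trans h
  rw [div_mul_eq_mul_div, le_div_iff₀ (mul_pos hlam12 hlam21)]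
  calc ‖xs (ys x₀) - xstar‖ * (lam12 * lam21)
      = lam21 * (lam12 * ‖xs (ys x₀) - xstar‖) := by ring
    _ ≤ lam21 * (L12 * ‖ys x₀ - ystar‖) := by gcongr
    _ = L12 * (lam21 * ‖ys x₀ - ystar‖) := by ring
    _ ≤ L12 * (L21 * ‖x₀ - xstar‖) := by gcongr
    _ = L12 * L21 * ‖x₀ - xstar‖ := by ring
end

section
/- One-step contraction of alternating minimization in the second block (Theorem 3, second conclusion). Under the setup in the context, for every y₀ ∈ F with ‖y₀ − y⋆‖ < ε_y, the next alternating-minimization iterate y₁ := ys (xs y₀) satisfies ‖y₁ − y⋆‖ ≤ (L₁₂·L₂₁)/(λ₁₂·λ₂₁) · ‖y₀ − y⋆‖. -/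
/-- One-step contraction of alternating minimization in the second block
(Theorem 3, second conclusion). -/
theorem alt_min_one_step_second_block
    {E F : Type*} [NormedAddCommGroup E] [InnerProductSpace ℝ E] [FiniteDimensional ℝ E]
    [NormedAddCommGroup F] [InnerProductSpace ℝ F] [FiniteDimensional ℝ F]
    (f : E × F → ℝ) (hf : Differentiable ℝ f)
    (xs : F → E) (ys : E → F) (xstar : E) (ystar : F)
    (L12 L21 lam12 lam21 εx εy : ℝ)
    (hL12 : 0 ≤ L12) (hL21 : 0 ≤ L21) (hlam12 : 0 < lam12) (hlam21 : 0 < lam21)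
    (hεx : 0 < εx) (hεy : 0 < εy)
    (hball1 : L21 * εx ≤ lam21 * εy) (hball2 : L12 * εy ≤ lam12 * εx)
    (hfoc1 : ∀ y : F, gradient (fun x => f (x, y)) (xs y) = 0)
    (hfoc2 : ∀ x : E, gradient (fun y => f (x, y)) (ys x) = 0)
    (hfix1 : xs ystar = xstar) (hfix2 : ys xstar = ystar)
    (hcs1 : ∀ x : E, ∀ y : F, ‖y - ystar‖ < εy →
      ‖gradient (fun x' => f (x', y)) x - gradient (fun x' => f (x', ystar)) x‖
        ≤ L12 * ‖y - ystar‖)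
    (hcs2 : ∀ y : F, ∀ x : E, ‖x - xstar‖ < εx →
      ‖gradient (fun y' => f (x, y')) y - gradient (fun y' => f (xstar, y')) y‖
        ≤ L21 * ‖x - xstar‖)
    (hqg1 : ∀ x : E, lam12 * ‖x - xstar‖ ≤ ‖gradient (fun x' => f (x', ystar)) x‖)
    (hqg2 : ∀ y : F, lam21 * ‖y - ystar‖ ≤ ‖gradient (fun y' => f (xstar, y')) y‖)
    (y₀ : F) (hy₀ : ‖y₀ - ystar‖ < εy) :
    ‖ys (xs y₀) - ystar‖ ≤ (L12 * L21) / (lam12 * lam21) * ‖y₀ - ystar‖ := by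
  have hx : lam12 * ‖xs y₀ - xstar‖ ≤ L12 * ‖y₀ - ystar‖ := by
    have h := hcs1 (xs y₀) y₀ hy₀
    rw [hfoc1, zero_sub, norm_neg] at h
    exact (hqg1 _).trans h
  have hx_ball : ‖xs y₀ - xstar‖ < εx := by
    refine lt_of_mul_lt_mul_left ?_ hlam12.le
    rcases hL12.eq_or_lt with h0 | hpos
    · rw [← h0, zero_mul] at hx
      exact hx.trans_lt (mul_pos hlam12 hεx)
    · exact hx.trans_lt ((mul_lt_mul_of_pos_left hy₀ hpos).trans_le hball2)
  have hy : lam21 * ‖ys (xs y₀) - ystar‖ ≤ L21 * ‖xs y₀ - xstar‖ := by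
    have h := hcs2 (ys (xs y₀)) (xs y₀) hx_ball
    rw [hfoc2, zero_sub, norm_neg] at h
    exact (hqg2 _).trans h
  rw [div_mul_eq_mul_div, le_div_iff₀ (mul_pos hlam12 hlam21)]
  calc ‖ys (xs y₀) - ystar‖ * (lam12 * lam21)
      = lam12 * (lam21 * ‖ys (xs y₀) - ystar‖) := by ring
    _ ≤ lam12 * (L21 * ‖xs y₀ - xstar‖) := by gcongr
    _ = L21 * (lam12 * ‖xs y₀ - xstar‖) := by ring
    _ ≤ L21 * (L12 * ‖y₀ - ystar‖) := by gcongr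
    _ = L12 * L21 * ‖y₀ - ystar‖ := by ring
end

section
/- Exponential convergence of alternating minimization (Theorem 3, final conclusion). Under the setup in the context, assume additionally that L₁₂·L₂₁ < λ₁₂·λ₂₁ and set r := (L₁₂·L₂₁)/(λ₁₂·λ₂₁). Then for any y₀ with ‖y₀ − y⋆‖ < ε_y, the sequence defined by y_{k+1} := ys (xs y_k) satisfies ‖y_k − y⋆‖ < ε_y for all k ≥ 0 and ‖y_k − y⋆‖ ≤ r^k · ‖y₀ − y⋆‖; similarly, for any x₀ with ‖x₀ − x⋆‖ < ε_x, the sequence x_{k+1} := xs (ys x_k) satisfies ‖x_k − x⋆‖ ≤ r^k · ‖x₀ − x⋆‖ for all k ≥ 0. -/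
theorem lt_of_mul_le_mul_of_scaled_radius {lam L a b ε δ : ℝ} (hlam : 0 < lam) (hL : 0 ≤ L)
    (hδ : 0 < δ) (hball : L * ε ≤ lam * δ) (hab : lam * a ≤ L * b) (hb : b < ε) : a < δ := by
  refine lt_of_mul_lt_mul_left (lt_of_le_of_lt hab ?_) hlam.le
  rcases hL.eq_or_lt with rfl | hL
  · simpa using mul_pos hlam hδ
  · exact (mul_lt_mul_of_pos_left hb hL).trans_le hball

theorem geometric_bound_of_local_contraction {d : ℕ → ℝ} {r ε : ℝ} (hr : 0 ≤ r) (h0 : d 0 < ε)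
    (hstep : ∀ k, d k < ε → d (k + 1) < ε ∧ d (k + 1) ≤ r * d k) (k : ℕ) :
    d k < ε ∧ d k ≤ r ^ k * d 0 := by
  induction k with
  | zero => simpa using h0
  | succ k ih =>
    obtain ⟨hlt, hle⟩ := hstep k ih.1
    refine ⟨hlt, hle.trans ?_⟩
    rw [pow_succ', mul_assoc]
    exact mul_le_mul_of_nonneg_left ih.2 hr

theorem le_div_mul_of_mul_le_mul_of_mul_le_mul {lam mu L M a b c : ℝ} (hlam : 0 < lam)
    (hmu : 0 < mu) (hM : 0 ≤ M) (hba : lam * b ≤ L * a) (hcb : mu * c ≤ M * b) :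
    c ≤ L * M / (lam * mu) * a := by
  rw [div_mul_eq_mul_div, le_div_iff₀ (mul_pos hlam hmu)]
  calc c * (lam * mu) = lam * (mu * c) := by ring
    _ ≤ lam * (M * b) := mul_le_mul_of_nonneg_left hcb hlam.le
    _ = M * (lam * b) := by ring
    _ ≤ M * (L * a) := mul_le_mul_of_nonneg_left hba hM
    _ = L * M * a := by ring

theorem alt_min_exponential_convergence
    {E F : Type*} [NormedAddCommGroup E] [InnerProductSpace ℝ E] [FiniteDimensional ℝ E]
    [NormedAddCommGroup F] [InnerProductSpace ℝ F] [FiniteDimensional ℝ F]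
    (f : E × F → ℝ) (hf : Differentiable ℝ f)
    (xs : F → E) (ys : E → F) (xstar : E) (ystar : F)
    (L12 L21 lam12 lam21 εx εy : ℝ)
    (hL12 : 0 ≤ L12) (hL21 : 0 ≤ L21) (hlam12 : 0 < lam12) (hlam21 : 0 < lam21)
    (hεx : 0 < εx) (hεy : 0 < εy)
    (hball1 : L21 * εx ≤ lam21 * εy) (hball2 : L12 * εy ≤ lam12 * εx)
    (hfoc1 : ∀ y : F, gradient (fun x => f (x, y)) (xs y) = 0)
    (hfoc2 : ∀ x : E, gradient (fun y => f (x, y)) (ys x) = 0)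
    (hfix1 : xs ystar = xstar) (hfix2 : ys xstar = ystar)
    (hcs1 : ∀ x : E, ∀ y : F, ‖y - ystar‖ < εy →
      ‖gradient (fun x' => f (x', y)) x - gradient (fun x' => f (x', ystar)) x‖
        ≤ L12 * ‖y - ystar‖)
    (hcs2 : ∀ y : F, ∀ x : E, ‖x - xstar‖ < εx →
      ‖gradient (fun y' => f (x, y')) y - gradient (fun y' => f (xstar, y')) y‖
        ≤ L21 * ‖x - xstar‖)
    (hqg1 : ∀ x : E, lam12 * ‖x - xstar‖ ≤ ‖gradient (fun x' => f (x', ystar)) x‖)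
    (hqg2 : ∀ y : F, lam21 * ‖y - ystar‖ ≤ ‖gradient (fun y' => f (xstar, y')) y‖)
    (hrate : L12 * L21 < lam12 * lam21) :
    (∀ y : ℕ → F, ‖y 0 - ystar‖ < εy → (∀ k, y (k + 1) = ys (xs (y k))) →
      ∀ k, ‖y k - ystar‖ < εy ∧
        ‖y k - ystar‖ ≤ ((L12 * L21) / (lam12 * lam21)) ^ k * ‖y 0 - ystar‖) ∧
    (∀ x : ℕ → E, ‖x 0 - xstar‖ < εx → (∀ k, x (k + 1) = xs (ys (x k))) →
      ∀ k, ‖x k - xstar‖ ≤ ((L12 * L21) / (lam12 * lam21)) ^ k * ‖x 0 - xstar‖) := by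
  have hx : ∀ y, ‖y - ystar‖ < εy → lam12 * ‖xs y - xstar‖ ≤ L12 * ‖y - ystar‖ := fun y hy =>
    (hqg1 (xs y)).trans (by simpa [hfoc1 y] using hcs1 (xs y) y hy)
  have hy : ∀ x, ‖x - xstar‖ < εx → lam21 * ‖ys x - ystar‖ ≤ L21 * ‖x - xstar‖ := fun x hx =>
    (hqg2 (ys x)).trans (by simpa [hfoc2 x] using hcs2 (ys x) x hx)
  have hxball : ∀ y, ‖y - ystar‖ < εy → ‖xs y - xstar‖ < εx := fun y h =>
    lt_of_mul_le_mul_of_scaled_radius hlam12 hL12 hεx hball2 (hx y h) h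
  have hyball : ∀ x, ‖x - xstar‖ < εx → ‖ys x - ystar‖ < εy := fun x h =>
    lt_of_mul_le_mul_of_scaled_radius hlam21 hL21 hεy hball1 (hy x h) h
  have hr : 0 ≤ L12 * L21 / (lam12 * lam21) := by positivity
  constructor
  · intro y h0 hrec
    refine geometric_bound_of_local_contraction (d := fun k => ‖y k - ystar‖) hr h0 fun k hk => ?_
    simp only [hrec k]
    exact ⟨hyball _ (hxball _ hk), le_div_mul_of_mul_le_mul_of_mul_le_mul hlam12 hlam21 hL21
      (hx _ hk) (hy _ (hxball _ hk))⟩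
  · intro x h0 hrec k
    refine (geometric_bound_of_local_contraction (d := fun k => ‖x k - xstar‖) hr h0
      (fun k hk => ?_) k).2
    simp only [hrec k]
    refine ⟨hxball _ (hyball _ hk), ?_⟩
    rw [mul_comm L12, mul_comm lam12]
    exact le_div_mul_of_mul_le_mul_of_mul_le_mul hlam21 hlam12 hL12
      (hy _ hk) (hx _ (hyball _ hk))
end

section
/- Convergence rate of CAVI for Bayesian probit regression under the ridge prior (Corollary 2, part (i), finite-sample statement). Let X be a real n×p matrix with p ≥ 1, let c > 0, and set Q₀ := (p/c)•1 (p×p identity scaled by p/c). Then the rate r := λ_max((Q₀ + XᵀX)⁻¹ XᵀX) satisfies r = (c/p)·λ_max(XᵀX) / (1 + (c/p)·λ_max(XᵀX)), and in particular r < 1. -/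
open Matrix

/-- `λ_max` of a real square matrix with real spectrum: the largest element of its spectrum. -/
noncomputable def lamMax {p : ℕ} (A : Matrix (Fin p) (Fin p) ℝ) : ℝ :=
  sSup (spectrum ℝ A)

/-- `λ_max` is attained when the spectrum is nonempty. -/
theorem lamMax_isGreatest {p : ℕ} {A : Matrix (Fin p) (Fin p) ℝ}
    (h : (spectrum ℝ A).Nonempty) : IsGreatest (spectrum ℝ A) (lamMax A) :=
  have hfin : (spectrum ℝ A).Finite := Matrix.finite_real_spectrum
  ⟨h.csSup_mem hfin, fun _ hx => le_csSup hfin.bddAbove hx⟩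

theorem spectrum_nonempty_of_isHermitian {ι : Type*} [Fintype ι] [DecidableEq ι] [Nonempty ι]
    {A : Matrix ι ι ℝ} (hA : A.IsHermitian) : (spectrum ℝ A).Nonempty := by
  rw [hA.spectrum_real_eq_range_eigenvalues]
  exact Set.range_nonempty _

theorem nonneg_of_mem_spectrum_of_posSemidef {ι : Type*} [Fintype ι] [DecidableEq ι]
    {A : Matrix ι ι ℝ} (hA : A.PosSemidef) {t : ℝ} (ht : t ∈ spectrum ℝ A) : 0 ≤ t := by
  rw [hA.isHermitian.spectrum_real_eq_range_eigenvalues] at ht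
  obtain ⟨i, rfl⟩ := ht
  exact hA.eigenvalues_nonneg i

theorem isUnit_smul_one_add_of_posSemidef {ι : Type*} [Fintype ι] [DecidableEq ι]
    {A : Matrix ι ι ℝ} (hA : A.PosSemidef) {a : ℝ} (ha : 0 < a) :
    IsUnit (a • (1 : Matrix ι ι ℝ) + A) := by
  have h : -a ∉ spectrum ℝ A := fun h => by
    linarith [nonneg_of_mem_spectrum_of_posSemidef hA h]
  rw [spectrum.notMem_iff, Algebra.algebraMap_eq_smul_one] at h
  convert h.neg using 1
  module

theorem div_mem_spectrum_inv_mul_iff {ι : Type*} [Fintype ι] [DecidableEq ι]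
    {A : Matrix ι ι ℝ} {a t : ℝ} (ha : a ≠ 0) (hat : a + t ≠ 0)
    (hu : IsUnit (a • (1 : Matrix ι ι ℝ) + A)) :
    t / (a + t) ∈ spectrum ℝ ((a • (1 : Matrix ι ι ℝ) + A)⁻¹ * A) ↔ t ∈ spectrum ℝ A := by
  set M := a • (1 : Matrix ι ι ℝ) + A with hM
  have hdet : IsUnit M.det := (Matrix.isUnit_iff_isUnit_det M).mp hu
  have hlin : (t / (a + t)) • M - A = (a / (a + t)) • (t • (1 : Matrix ι ι ℝ) - A) := by
    rw [hM]
    match_scalars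
    · field_simp
    · field_simp
      ring
  have key : (t / (a + t)) • (1 : Matrix ι ι ℝ) - M⁻¹ * A
      = M⁻¹ * ((a / (a + t)) • (t • (1 : Matrix ι ι ℝ) - A)) := by
    rw [← hlin, mul_sub, mul_smul_comm, Matrix.nonsing_inv_mul _ hdet]
  have hinv : IsUnit M⁻¹ := Matrix.isUnit_nonsing_inv_iff.mpr hu
  have hk : IsUnit (a / (a + t)) := (div_ne_zero ha hat).isUnit
  rw [spectrum.mem_iff, spectrum.mem_iff, Algebra.algebraMap_eq_smul_one,
    Algebra.algebraMap_eq_smul_one, key, hinv.mul_left_iff]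
  exact not_congr (isUnit_smul_iff hk.unit _)

theorem one_notMem_spectrum_inv_mul {ι : Type*} [Fintype ι] [DecidableEq ι]
    {A : Matrix ι ι ℝ} {a : ℝ} (ha : a ≠ 0) (hu : IsUnit (a • (1 : Matrix ι ι ℝ) + A)) :
    (1 : ℝ) ∉ spectrum ℝ ((a • (1 : Matrix ι ι ℝ) + A)⁻¹ * A) := by
  set M := a • (1 : Matrix ι ι ℝ) + A with hM
  have hdet : IsUnit M.det := (Matrix.isUnit_iff_isUnit_det M).mp hu
  have key : (1 : Matrix ι ι ℝ) - M⁻¹ * A = a • M⁻¹ := by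
    have h : A = M - a • (1 : Matrix ι ι ℝ) := by rw [hM]; abel
    conv_lhs => rw [h]
    rw [mul_sub, Matrix.nonsing_inv_mul _ hdet, mul_smul_comm, mul_one, sub_sub_cancel]
  rw [spectrum.notMem_iff, map_one, key]
  exact (isUnit_smul_iff ha.isUnit.unit _).mpr (Matrix.isUnit_nonsing_inv_iff.mpr hu)

theorem lamMax_inv_mul_of_posSemidef {p : ℕ} [NeZero p] {A : Matrix (Fin p) (Fin p) ℝ}
    (hA : A.PosSemidef) {a : ℝ} (ha : 0 < a) :
    lamMax ((a • (1 : Matrix (Fin p) (Fin p) ℝ) + A)⁻¹ * A) = lamMax A / (a + lamMax A) := by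
  have hu := isUnit_smul_one_add_of_posSemidef hA ha
  have hL := lamMax_isGreatest (spectrum_nonempty_of_isHermitian hA.isHermitian)
  have hL0 := nonneg_of_mem_spectrum_of_posSemidef hA hL.1
  have hmem := (div_mem_spectrum_inv_mul_iff ha.ne' (by positivity) hu).mpr hL.1
  refine (lamMax_isGreatest ⟨_, hmem⟩).unique ⟨hmem, fun μ hμ => ?_⟩
  have hμ1 : 1 - μ ≠ 0 := fun h => one_notMem_spectrum_inv_mul ha.ne' hu <| by
    rwa [← sub_eq_zero.mp h] at hμ
  have hsum : a + a * μ / (1 - μ) = a / (1 - μ) := by field_simp; ring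
  have hsum0 : a + a * μ / (1 - μ) ≠ 0 := hsum ▸ div_ne_zero ha.ne' hμ1
  have hdiv : a * μ / (1 - μ) / (a + a * μ / (1 - μ)) = μ := by
    rw [hsum]; field_simp
  have ht : a * μ / (1 - μ) ∈ spectrum ℝ A :=
    (div_mem_spectrum_inv_mul_iff ha.ne' hsum0 hu).mp (by rwa [hdiv])
  have ht0 := nonneg_of_mem_spectrum_of_posSemidef hA ht
  have htL := hL.2 ht
  rw [← hdiv, div_le_div_iff₀ (by positivity) (by positivity)]
  nlinarith

/-- Convergence rate of CAVI for Bayesian probit regression under the ridge prior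
`Q₀ = (p/c) • 1` (Corollary 2, part (i), finite-sample statement). -/
theorem probit_ridge_prior_rate {n p : ℕ} (hp : 1 ≤ p)
    (X : Matrix (Fin n) (Fin p) ℝ) (c : ℝ) (hc : 0 < c) :
    lamMax ((((p : ℝ) / c) • (1 : Matrix (Fin p) (Fin p) ℝ) + Xᵀ * X)⁻¹ * (Xᵀ * X))
        = (c / p) * lamMax (Xᵀ * X) / (1 + (c / p) * lamMax (Xᵀ * X)) ∧
    lamMax ((((p : ℝ) / c) • (1 : Matrix (Fin p) (Fin p) ℝ) + Xᵀ * X)⁻¹ * (Xᵀ * X)) < 1 := by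
  have : NeZero p := ⟨by omega⟩
  have hp0 : (0 : ℝ) < p := by exact_mod_cast hp
  have hA : (Xᵀ * X).PosSemidef := by
    simpa using Matrix.posSemidef_conjTranspose_mul_self X
  have hL0 : 0 ≤ lamMax (Xᵀ * X) := nonneg_of_mem_spectrum_of_posSemidef hA
    (lamMax_isGreatest (spectrum_nonempty_of_isHermitian hA.isHermitian)).1
  have ha : 0 < (p : ℝ) / c := by positivity
  rw [lamMax_inv_mul_of_posSemidef hA ha]
  refine ⟨by field_simp, ?_⟩
  rw [div_lt_one (by positivity)]
  linarith
end

section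
/- Convergence rate of CAVI for Bayesian probit regression under the generalized g-prior (Corollary 2, part (ii), finite-sample statement). Let X be a real n×p matrix with p ≥ 1, let g > 0 and c > 0, and set Q₀ := (1/g)•XᵀX + c•1. Then the rate r := λ_max((Q₀ + XᵀX)⁻¹ XᵀX) satisfies r = λ_max(XᵀX) / ((1 + 1/g)·λ_max(XᵀX) + c), and in particular r < 1. -/
open Matrix

/-- If `k • S + c • 1` is invertible with `k` and `c` nonzero, the spectrum of `(k • S + c • 1)⁻¹ * S`
is the image of the spectrum of `S` under `x ↦ x / (k * x + c)`. -/
theorem spectrum_inv_smul_add_mul_self {p : ℕ} (S : Matrix (Fin p) (Fin p) ℝ) {k c : ℝ}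
    (hk : k ≠ 0) (hc : c ≠ 0)
    (hM : IsUnit (k • S + c • (1 : Matrix (Fin p) (Fin p) ℝ))) :
    spectrum ℝ ((k • S + c • (1 : Matrix (Fin p) (Fin p) ℝ))⁻¹ * S)
      = (fun x => x / (k * x + c)) '' spectrum ℝ S := by
  have key (μ : ℝ) : μ ∈ spectrum ℝ ((k • S + c • (1 : Matrix (Fin p) (Fin p) ℝ))⁻¹ * S) ↔
      ¬ IsUnit ((μ * k - 1) • S + (μ * c) • (1 : Matrix (Fin p) (Fin p) ℝ)) := by
    have hdet := (Matrix.isUnit_iff_isUnit_det _).1 hM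
    rw [spectrum.mem_iff, Algebra.algebraMap_eq_smul_one, ← hM.mul_left_iff, mul_sub,
      Matrix.mul_nonsing_inv_cancel_left _ _ hdet, mul_smul_comm, mul_one]
    rw [show μ • (k • S + c • (1 : Matrix (Fin p) (Fin p) ℝ)) - S
      = (μ * k - 1) • S + (μ * c) • (1 : Matrix (Fin p) (Fin p) ℝ) by module]
  have key' {a : ℝ} (ha : a ≠ 0) (b : ℝ) :
      ¬ IsUnit (a • S + b • (1 : Matrix (Fin p) (Fin p) ℝ)) ↔ -b / a ∈ spectrum ℝ S := by
    rw [spectrum.mem_iff, Algebra.algebraMap_eq_smul_one,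
      ← isUnit_smul_iff (Units.mk0 (-a) (neg_ne_zero.2 ha)) ((-b / a) • _ - S)]
    have : -a * (-b / a) = b := by field_simp
    rw [Units.smul_mk0, smul_sub, smul_smul, this, neg_smul, sub_neg_eq_add, add_comm]
  ext μ
  rw [key, Set.mem_image]
  constructor
  · intro h
    have hμ : μ * k - 1 ≠ 0 := by
      intro h0
      refine h ?_
      have hμ0 : μ * c ≠ 0 := mul_ne_zero (by rintro rfl; simp at h0) hc
      rw [h0, zero_smul, zero_add]
      exact isUnit_one.smul (Units.mk0 _ hμ0)
    refine ⟨_, (key' hμ _).1 h, ?_⟩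
    have : k * (-(μ * c) / (μ * k - 1)) + c = -c / (μ * k - 1) := by
      rw [eq_div_iff hμ, add_mul, mul_assoc, div_mul_cancel₀ _ hμ]
      ring
    rw [this]
    field_simp
  · rintro ⟨x, hx, rfl⟩
    have hx0 : k * x + c ≠ 0 := by
      intro h0
      have : -c / k = x := by
        field_simp
        linarith
      exact (key' hk c).2 (this ▸ hx) hM
    have h1 : x / (k * x + c) * k - 1 = -c / (k * x + c) := by
      rw [eq_div_iff hx0, sub_mul, mul_right_comm, div_mul_cancel₀ _ hx0]
      ring
    rw [h1, key' (div_ne_zero (neg_ne_zero.2 hc) hx0)]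
    convert hx using 1
    rw [div_mul_eq_mul_div, ← neg_div, div_div_div_cancel_right₀ hx0, neg_div_neg_eq,
      mul_div_cancel_right₀ _ hc]

/-- The spectrum of a nonempty real symmetric matrix has `lamMax` as greatest element. -/
theorem isGreatest_lamMax {p : ℕ} (hp : 1 ≤ p) {S : Matrix (Fin p) (Fin p) ℝ}
    (hS : S.IsHermitian) : IsGreatest (spectrum ℝ S) (lamMax S) := by
  have : Nonempty (Fin p) := ⟨⟨0, hp⟩⟩
  have hfin : (spectrum ℝ S).Finite := by
    rw [hS.spectrum_real_eq_range_eigenvalues]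
    exact Set.finite_range _
  have hne : (spectrum ℝ S).Nonempty := by
    rw [hS.spectrum_real_eq_range_eigenvalues]
    exact Set.range_nonempty _
  exact ⟨hne.csSup_mem hfin, fun _ hx => le_csSup hfin.bddAbove hx⟩

/-- Convergence rate of CAVI for Bayesian probit regression under the generalized g-prior
`Q₀ = (1/g) • XᵀX + c • 1` (Corollary 2, part (ii), finite-sample statement). -/
theorem probit_g_prior_rate {n p : ℕ} (hp : 1 ≤ p)
    (X : Matrix (Fin n) (Fin p) ℝ) (g c : ℝ) (hg : 0 < g) (hc : 0 < c) :
    lamMax ((((1 / g) • (Xᵀ * X) + c • (1 : Matrix (Fin p) (Fin p) ℝ)) + Xᵀ * X)⁻¹ * (Xᵀ * X))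
        = lamMax (Xᵀ * X) / ((1 + 1 / g) * lamMax (Xᵀ * X) + c) ∧
    lamMax ((((1 / g) • (Xᵀ * X) + c • (1 : Matrix (Fin p) (Fin p) ℝ)) + Xᵀ * X)⁻¹ * (Xᵀ * X))
        < 1 := by
  have hS : (Xᵀ * X).PosSemidef := by
    simpa using Matrix.posSemidef_conjTranspose_mul_self X
  have hnonneg : ∀ x ∈ spectrum ℝ (Xᵀ * X), 0 ≤ x := by
    rw [hS.isHermitian.spectrum_real_eq_range_eigenvalues]
    rintro _ ⟨i, rfl⟩
    exact hS.eigenvalues_nonneg i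
  have hg' : 0 < 1 / g := by positivity
  have hk : 0 < 1 + 1 / g := by positivity
  have hM : IsUnit ((1 + 1 / g) • (Xᵀ * X) + c • (1 : Matrix (Fin p) (Fin p) ℝ)) :=
    ((Matrix.PosDef.one.smul hc).posSemidef_add (hS.smul hk.le)).isUnit
  have hgr := isGreatest_lamMax hp hS.isHermitian
  have hmono : MonotoneOn (fun x => x / ((1 + 1 / g) * x + c)) (spectrum ℝ (Xᵀ * X)) := by
    intro x hx y hy hxy
    have hx := hnonneg x hx
    have hy := hnonneg y hy
    have : c * x ≤ c * y := by gcongr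
    change x / _ ≤ y / _
    rw [div_le_div_iff₀ (by positivity) (by positivity)]
    linarith
  have hrate : lamMax ((((1 / g) • (Xᵀ * X) + c • (1 : Matrix (Fin p) (Fin p) ℝ)) + Xᵀ * X)⁻¹
      * (Xᵀ * X)) = lamMax (Xᵀ * X) / ((1 + 1 / g) * lamMax (Xᵀ * X) + c) := by
    rw [show ((1 / g) • (Xᵀ * X) + c • (1 : Matrix (Fin p) (Fin p) ℝ)) + Xᵀ * X
      = (1 + 1 / g) • (Xᵀ * X) + c • (1 : Matrix (Fin p) (Fin p) ℝ) by module]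
    conv_lhs => rw [lamMax, spectrum_inv_smul_add_mul_self _ hk.ne' hc.ne' hM]
    exact (hmono.map_isGreatest hgr).csSup_eq
  have hl := hnonneg _ hgr.1
  refine ⟨hrate, ?_⟩
  rw [hrate, div_lt_one (by positivity)]
  nlinarith [mul_nonneg hg'.le hl]
end

section
/- Derivative bound for the Pólya–Gamma mean function φ (used in the logistic regression corollary). Define φ : ℝ → ℝ by φ(c) := tanh(c/2)/(2c) for c ≠ 0. Then φ is differentiable on ℝ \ {0} and for every real c ≠ 0, |φ'(c) · c| < φ(c). -/
/-- The Pólya–Gamma mean function `φ(c) = tanh(c/2)/(2c)`. -/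
noncomputable def pgMean (c : ℝ) : ℝ := Real.tanh (c / 2) / (2 * c)

theorem hasDerivAt_tanh_real (x : ℝ) : HasDerivAt Real.tanh (1 / Real.cosh x ^ 2) x := by
  have h := (Real.hasDerivAt_sinh x).div (Real.hasDerivAt_cosh x) (Real.cosh_pos x).ne'
  have e : Real.tanh = Real.sinh / Real.cosh := funext Real.tanh_eq_sinh_div_cosh
  rw [e]
  refine h.congr_deriv ?_
  congr 1
  linarith [Real.cosh_sq x]

theorem hasDerivAt_pgMean {c : ℝ} (hc : c ≠ 0) :
    HasDerivAt pgMean ((1 / (4 * Real.cosh (c / 2) ^ 2) - pgMean c) / c) c := by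
  have h := ((hasDerivAt_tanh_real (c / 2)).comp c ((hasDerivAt_id c).div_const 2)).div
    ((hasDerivAt_id c).const_mul 2) (mul_ne_zero two_ne_zero hc)
  refine h.congr_deriv ?_
  have hcosh := (Real.cosh_pos (c / 2)).ne'
  simp only [pgMean, Function.comp_apply, id_eq]
  field_simp
  ring

theorem one_lt_sinh_div_self {x : ℝ} (hx : x ≠ 0) : 1 < Real.sinh x / x := by
  rcases hx.lt_or_gt with h | h
  · rw [lt_div_iff_of_neg h, one_mul]
    exact Real.sinh_lt_self_iff.mpr h
  · rw [lt_div_iff₀ h, one_mul]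
    exact Real.self_lt_sinh_iff.mpr h

theorem inv_cosh_sq_lt_pgMean {c : ℝ} (hc : c ≠ 0) :
    1 / (4 * Real.cosh (c / 2) ^ 2) < pgMean c := by
  have hcosh := Real.cosh_pos (c / 2)
  have h1 := one_lt_sinh_div_self (div_ne_zero hc two_ne_zero)
  have h2 := Real.one_le_cosh (c / 2)
  have e : pgMean c = Real.sinh (c / 2) / (c / 2) * Real.cosh (c / 2) /
      (4 * Real.cosh (c / 2) ^ 2) := by
    rw [pgMean, Real.tanh_eq_sinh_div_cosh]
    field_simp
    ring
  rw [e]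
  gcongr
  nlinarith

/-- Derivative bound for the Pólya–Gamma mean function: `φ` is differentiable away from `0`
and `|φ'(c) · c| < φ(c)` for every `c ≠ 0`. -/
theorem pgMean_deriv_bound :
    DifferentiableOn ℝ pgMean ({0}ᶜ : Set ℝ) ∧
    ∀ c : ℝ, c ≠ 0 → |deriv pgMean c * c| < pgMean c := by
  refine ⟨fun c hc => (hasDerivAt_pgMean hc).differentiableAt.differentiableWithinAt,
    fun c hc => ?_⟩
  have h := inv_cosh_sq_lt_pgMean hc
  have hpos : 0 < 1 / (4 * Real.cosh (c / 2) ^ 2) := by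
    have := Real.cosh_pos (c / 2)
    positivity
  rw [(hasDerivAt_pgMean hc).deriv, div_mul_cancel₀ _ hc, abs_lt]
  constructor <;> linarith
end

section
/- Global exponential convergence of CAVI for Bayesian probit regression (Proposition 2, restated in terms of the variational means). Let X be a real n×p matrix with rows x₁,…,x_n, let y₁,…,y_n ∈ {0,1}, let Q₀ be a real symmetric positive definite p×p matrix and m₀ ∈ ℝ^p, and set Q := Q₀ + XᵀX. Let ϕ denote the standard normal density and Φ the standard normal cumulative distribution function, and define g_i(t) := t + (2y_i − 1)·ϕ(t)/Φ((2y_i − 1)·t). Define the CAVI mean-update map T : ℝ^p → ℝ^p by T(m) := Q⁻¹·(Q₀ m₀ + Σ_{i=1}^n g_i(⟨x_i, m⟩)·x_i). Then for all m, m' ∈ ℝ^p, ‖T(m) − T(m')‖_Q ≤ r·‖m − m'‖_Q, where r := λ_max((Q₀ + XᵀX)⁻¹XᵀX) < 1 and ‖v‖_Q := √(vᵀQv). Consequently T has a unique fixed point m⋆ and the probit CAVI iterates converge globally exponentially fast at rate r. -/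
open Matrix

/-- The standard normal density `ϕ`. -/
noncomputable def stdNormalPdf (t : ℝ) : ℝ := Real.exp (-t ^ 2 / 2) / Real.sqrt (2 * Real.pi)

/-- The standard normal cumulative distribution function `Φ`. -/
noncomputable def stdNormalCdf (t : ℝ) : ℝ := ∫ s in Set.Iic t, stdNormalPdf s

open MeasureTheory Filter Topology

lemma stdNormalPdf_pos (t : ℝ) : 0 < stdNormalPdf t := by
  unfold stdNormalPdf; positivity

lemma stdNormalPdf_neg (t : ℝ) : stdNormalPdf (-t) = stdNormalPdf t := by
  simp [stdNormalPdf]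

lemma hasDerivAt_stdNormalPdf (t : ℝ) :
    HasDerivAt stdNormalPdf (-(t * stdNormalPdf t)) t := by
  have h : HasDerivAt (fun s : ℝ => -s ^ 2 / 2) (-t) t := by
    convert! ((hasDerivAt_pow 2 t).neg.div_const 2) using 1
    ring
  convert! h.exp.div_const (Real.sqrt (2 * Real.pi)) using 1
  unfold stdNormalPdf
  ring

lemma continuous_stdNormalPdf : Continuous stdNormalPdf :=
  continuous_iff_continuousAt.2 fun t => (hasDerivAt_stdNormalPdf t).continuousAt

lemma integrable_pow_mul_stdNormalPdf (k : ℕ) :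
    Integrable fun t => t ^ k * stdNormalPdf t := by
  have h := (integrable_rpow_mul_exp_neg_mul_sq (b := 1 / 2) (by norm_num)
    (s := k) (by linarith [k.cast_nonneg (α := ℝ)])).div_const (Real.sqrt (2 * Real.pi))
  refine h.congr (.of_forall fun t => ?_)
  simp only [stdNormalPdf, Real.rpow_natCast, mul_div_assoc]
  ring_nf

lemma integrable_stdNormalPdf : Integrable stdNormalPdf := by
  simpa using integrable_pow_mul_stdNormalPdf 0

lemma integrable_mul_stdNormalPdf : Integrable fun t => t * stdNormalPdf t := by
  simpa using integrable_pow_mul_stdNormalPdf 1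

lemma stdNormalCdf_pos (t : ℝ) : 0 < stdNormalCdf t := by
  unfold stdNormalCdf
  rw [setIntegral_pos_iff_support_of_nonneg_ae
    (.of_forall fun s => (stdNormalPdf_pos s).le) integrable_stdNormalPdf.integrableOn]
  have : Function.support stdNormalPdf = Set.univ :=
    Set.eq_univ_of_forall fun s => (stdNormalPdf_pos s).ne'
  simp [this]

lemma hasDerivAt_stdNormalCdf (t : ℝ) : HasDerivAt stdNormalCdf (stdNormalPdf t) t := by
  have h : stdNormalCdf = fun x => stdNormalCdf 0 + ∫ s in (0 : ℝ)..x, stdNormalPdf s := by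
    funext x
    rw [← intervalIntegral.integral_Iic_sub_Iic integrable_stdNormalPdf.integrableOn
      integrable_stdNormalPdf.integrableOn]
    simp [stdNormalCdf]
  rw [h]
  exact (continuous_stdNormalPdf.integral_hasStrictDerivAt 0 t).hasDerivAt.const_add _

lemma integral_Iic_mul_stdNormalPdf (t : ℝ) :
    ∫ s in Set.Iic t, s * stdNormalPdf s = -stdNormalPdf t := by
  have hd (s : ℝ) : HasDerivAt (fun s => -stdNormalPdf s) (s * stdNormalPdf s) s := by
    convert! (hasDerivAt_stdNormalPdf s).neg using 1
    rw [neg_neg]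
  rw [integral_Iic_of_hasDerivAt_of_tendsto' (fun s _ => hd s)
    integrable_mul_stdNormalPdf.integrableOn
    (tendsto_zero_of_hasDerivAt_of_integrableOn_Iic (a := t) (fun s _ => hd s)
      integrable_mul_stdNormalPdf.integrableOn integrable_stdNormalPdf.neg.integrableOn)]
  simp

lemma integral_Iic_sq_mul_stdNormalPdf (t : ℝ) :
    ∫ s in Set.Iic t, s ^ 2 * stdNormalPdf s = stdNormalCdf t - t * stdNormalPdf t := by
  have hd (s : ℝ) : HasDerivAt (fun s => s * stdNormalPdf s)
      (stdNormalPdf s - s ^ 2 * stdNormalPdf s) s := by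
    convert! (hasDerivAt_id s).mul (hasDerivAt_stdNormalPdf s) using 1
    simp only [id_eq]
    ring
  have hi := (integrable_stdNormalPdf.sub (integrable_pow_mul_stdNormalPdf 2)).integrableOn
    (s := Set.Iic t)
  have h := integral_Iic_of_hasDerivAt_of_tendsto' (fun s _ => hd s) hi
    (tendsto_zero_of_hasDerivAt_of_integrableOn_Iic (a := t) (fun s _ => hd s) hi
      integrable_mul_stdNormalPdf.integrableOn)
  rw [integral_sub integrable_stdNormalPdf.integrableOn
    (integrable_pow_mul_stdNormalPdf 2).integrableOn] at h
  unfold stdNormalCdf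
  linarith

/-- `∫_{-∞}^t (a + b s)² ϕ(s) ds ≥ 0`, written out in terms of truncated Gaussian moments. -/
lemma truncated_second_moment_nonneg (a b t : ℝ) :
    0 ≤ a ^ 2 * stdNormalCdf t - 2 * a * b * stdNormalPdf t
      + b ^ 2 * (stdNormalCdf t - t * stdNormalPdf t) := by
  have h : 0 ≤ ∫ s in Set.Iic t, (a + b * s) ^ 2 * stdNormalPdf s :=
    integral_nonneg fun s => mul_nonneg (sq_nonneg _) (stdNormalPdf_pos s).le
  have e (s : ℝ) : (a + b * s) ^ 2 * stdNormalPdf s = a ^ 2 * stdNormalPdf s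
      + 2 * a * b * (s * stdNormalPdf s) + b ^ 2 * (s ^ 2 * stdNormalPdf s) := by ring
  have i₀ := (integrable_stdNormalPdf.const_mul (a ^ 2)).integrableOn (s := Set.Iic t)
  have i₁ := (integrable_mul_stdNormalPdf.const_mul (2 * a * b)).integrableOn (s := Set.Iic t)
  have i₂ := ((integrable_pow_mul_stdNormalPdf 2).const_mul (b ^ 2)).integrableOn (s := Set.Iic t)
  have i₀₁ : IntegrableOn (fun s => a ^ 2 * stdNormalPdf s + 2 * a * b * (s * stdNormalPdf s))
    (Set.Iic t) := i₀.add i₁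
  simp_rw [e] at h
  rw [integral_add i₀₁ i₂, integral_add i₀ i₁, integral_const_mul, integral_const_mul,
    integral_const_mul, integral_Iic_mul_stdNormalPdf, integral_Iic_sq_mul_stdNormalPdf] at h
  change 0 ≤ a ^ 2 * stdNormalCdf t + _ + _ at h
  linarith

lemma mul_stdNormalCdf_add_stdNormalPdf_nonneg (t : ℝ) :
    0 ≤ t * stdNormalCdf t + stdNormalPdf t := by
  have h : 0 ≤ ∫ s in Set.Iic t, (t * stdNormalPdf s - s * stdNormalPdf s) :=
    setIntegral_nonneg measurableSet_Iic fun s hs => by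
      rw [← sub_mul]
      exact mul_nonneg (sub_nonneg.2 hs) (stdNormalPdf_pos s).le
  rw [integral_sub (integrable_stdNormalPdf.const_mul t).integrableOn
    integrable_mul_stdNormalPdf.integrableOn, integral_const_mul,
    integral_Iic_mul_stdNormalPdf] at h
  unfold stdNormalCdf
  linarith

/-- The mean of `N(t, 1)` truncated to `(0, ∞)`, as a function of `t`. -/
noncomputable def truncatedMean (t : ℝ) : ℝ := t + stdNormalPdf t / stdNormalCdf t

lemma hasDerivAt_truncatedMean (t : ℝ) :
    HasDerivAt truncatedMean
      (1 + (-(t * stdNormalPdf t) * stdNormalCdf t - stdNormalPdf t * stdNormalPdf t)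
        / stdNormalCdf t ^ 2) t :=
  (hasDerivAt_id t).add ((hasDerivAt_stdNormalPdf t).div (hasDerivAt_stdNormalCdf t)
    (stdNormalCdf_pos t).ne')

lemma abs_deriv_truncatedMean_le_one (t : ℝ) : |deriv truncatedMean t| ≤ 1 := by
  rw [(hasDerivAt_truncatedMean t).deriv]
  have hΦ := stdNormalCdf_pos t
  have h₁ := mul_nonneg (stdNormalPdf_pos t).le (mul_stdNormalCdf_add_stdNormalPdf_nonneg t)
  have h₂ : 0 ≤ stdNormalCdf t ^ 2 - t * stdNormalPdf t * stdNormalCdf t - stdNormalPdf t ^ 2 := by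
    refine nonneg_of_mul_nonneg_right ?_ hΦ
    linarith [truncated_second_moment_nonneg (stdNormalPdf t) (stdNormalCdf t) t]
  rw [← div_self (pow_ne_zero 2 hΦ.ne'), ← add_div, abs_of_nonneg (by
    apply div_nonneg _ (sq_nonneg _); linarith), div_le_div_iff_of_pos_right (by positivity)]
  linarith

lemma abs_truncatedMean_sub_le (s t : ℝ) : |truncatedMean s - truncatedMean t| ≤ |s - t| := by
  have h : LipschitzWith 1 truncatedMean :=
    lipschitzWith_of_nnnorm_deriv_le (fun t => (hasDerivAt_truncatedMean t).differentiableAt)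
      fun t => abs_deriv_truncatedMean_le_one t
  simpa [Real.dist_eq] using h.dist_le_mul s t

section PosDef

variable {p : ℕ} {A Q : Matrix (Fin p) (Fin p) ℝ}

lemma Matrix.PosDef.exists_isUnit_transpose_mul_self (hQ : Q.PosDef) :
    ∃ L : Matrix (Fin p) (Fin p) ℝ, IsUnit L ∧ Q = Lᵀ * L := by
  obtain ⟨L, rfl⟩ : ∃ L : Matrix (Fin p) (Fin p) ℝ, Q = Lᵀ * L := by
    open scoped MatrixOrder in
    obtain ⟨L, hL⟩ := CStarAlgebra.nonneg_iff_eq_star_mul_self.mp hQ.posSemidef.nonneg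
    exact ⟨L, by simpa [star_eq_conjTranspose] using hL⟩
  exact ⟨L, isUnit_of_mul_isUnit_right hQ.isUnit, rfl⟩

lemma exists_generalized_eigenvector_of_mem_spectrum (hQ : Q.PosDef) {μ : ℝ}
    (hμ : μ ∈ spectrum ℝ (Q⁻¹ * A)) : ∃ v, v ≠ 0 ∧ A *ᵥ v = μ • (Q *ᵥ v) := by
  rw [← spectrum_toLin', ← Module.End.hasEigenvalue_iff_mem_spectrum] at hμ
  obtain ⟨v, hv⟩ := hμ.exists_hasEigenvector
  refine ⟨v, hv.2, ?_⟩
  have h := congrArg (Q *ᵥ ·) hv.apply_eq_smul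
  simpa [toLin'_apply, mulVec_smul,
    mul_nonsing_inv_cancel_left _ _ ((isUnit_iff_isUnit_det _).1 hQ.isUnit)] using h

lemma dotProduct_mulVec_le_lamMax_mul (hQ : Q.PosDef) (hA : A.IsHermitian) (v : Fin p → ℝ) :
    v ⬝ᵥ (A *ᵥ v) ≤ lamMax (Q⁻¹ * A) * (v ⬝ᵥ (Q *ᵥ v)) := by
  obtain ⟨L, hL, rfl⟩ := hQ.exists_isUnit_transpose_mul_self
  have hdet : IsUnit L.det := (isUnit_iff_isUnit_det _).1 hL
  set B : Matrix (Fin p) (Fin p) ℝ := (L⁻¹)ᵀ * A * L⁻¹ with hB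
  have hBA : Lᵀ * B * L = A := by
    have h : Lᵀ * (L⁻¹)ᵀ = 1 := by rw [← transpose_mul, nonsing_inv_mul _ hdet, transpose_one]
    rw [hB, ← mul_assoc, ← mul_assoc, h, one_mul, mul_assoc, nonsing_inv_mul _ hdet, mul_one]
  have hspec : spectrum ℝ ((Lᵀ * L)⁻¹ * A) = spectrum ℝ B := by
    rw [← spectrum.units_conjugate' (u := hL.unit) (a := B)]
    congr 1
    have h : ((hL.unit⁻¹ : (Matrix (Fin p) (Fin p) ℝ)ˣ) : Matrix (Fin p) (Fin p) ℝ) = L⁻¹ := by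
      rw [coe_units_inv, hL.unit_spec]
    rw [h, hL.unit_spec, hB, Matrix.mul_inv_rev, transpose_nonsing_inv, mul_assoc, mul_assoc,
      mul_assoc, nonsing_inv_mul _ hdet, mul_one]
  have hBherm : B.IsHermitian := by
    have h : Aᵀ = A := by simpa using hA.eq
    simp [Matrix.IsHermitian, hB, transpose_mul, h, mul_assoc]
  have hpsd : (algebraMap ℝ _ (lamMax ((Lᵀ * L)⁻¹ * A)) - B).PosSemidef := by
    refine posSemidef_iff_isHermitian_and_spectrum_nonneg.2 ⟨?_, ?_⟩
    · refine IsHermitian.sub ?_ hBherm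
      simp [Matrix.IsHermitian, algebraMap_eq_diagonal]
    · rw [← spectrum.singleton_sub_eq, ← hspec]
      rintro _ ⟨_, rfl, μ, hμ, rfl⟩
      exact sub_nonneg.2 (le_csSup (finite_spectrum _).bddAbove hμ)
  have h := hpsd.dotProduct_mulVec_nonneg (L *ᵥ v)
  have hQv : (L *ᵥ v) ⬝ᵥ (L *ᵥ v) = v ⬝ᵥ ((Lᵀ * L) *ᵥ v) := by
    rw [← mulVec_mulVec, dotProduct_mulVec v, vecMul_transpose]
  have hAv : (L *ᵥ v) ⬝ᵥ (B *ᵥ (L *ᵥ v)) = v ⬝ᵥ (A *ᵥ v) := by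
    conv_rhs => rw [← hBA, mul_assoc, ← mulVec_mulVec, ← mulVec_mulVec, dotProduct_mulVec,
      vecMul_transpose]
  rw [← hQv, ← hAv]
  simpa only [star_trivial, sub_mulVec, dotProduct_sub, Algebra.algebraMap_eq_smul_one, smul_mulVec,
    one_mulVec, dotProduct_smul, smul_eq_mul, sub_nonneg] using h

lemma lamMax_nonneg (hQ : Q.PosDef) (hA : A.PosSemidef) : 0 ≤ lamMax (Q⁻¹ * A) := by
  refine Real.sSup_nonneg fun μ hμ => ?_
  obtain ⟨v, hv, h⟩ := exists_generalized_eigenvector_of_mem_spectrum hQ hμ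
  have hAv := hA.dotProduct_mulVec_nonneg v
  rw [h, dotProduct_smul, smul_eq_mul] at hAv
  exact nonneg_of_mul_nonneg_left hAv (hQ.dotProduct_mulVec_pos hv)

lemma lamMax_add_inv_mul_lt_one {Q₀ : Matrix (Fin p) (Fin p) ℝ} (hQ₀ : Q₀.PosDef)
    (hA : A.PosSemidef) : lamMax ((Q₀ + A)⁻¹ * A) < 1 := by
  have hQ : (Q₀ + A).PosDef := hQ₀.add_posSemidef hA
  rcases (spectrum ℝ ((Q₀ + A)⁻¹ * A)).eq_empty_or_nonempty with h | h
  · simp [lamMax, h]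
  obtain ⟨v, hv, e⟩ := exists_generalized_eigenvector_of_mem_spectrum hQ
    (h.csSup_mem (finite_spectrum _))
  change A *ᵥ v = lamMax ((Q₀ + A)⁻¹ * A) • _ at e
  have hpos := hQ.dotProduct_mulVec_pos hv
  have hpos₀ := hQ₀.dotProduct_mulVec_pos hv
  have e' := congrArg (star v ⬝ᵥ ·) e
  simp only [dotProduct_smul, smul_eq_mul] at e'
  rw [← mul_lt_iff_lt_one_left hpos, ← e', add_mulVec, dotProduct_add]
  linarith

/-- If `|d i| ≤ |(X e) i|` for all `i`, then `Q⁻¹ Xᵀ d` is shorter than `e` in the `Q`-norm by the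
factor `λ_max (Q⁻¹ Xᵀ X)`. -/
lemma sqrt_inv_mulVec_transpose_mulVec_le {n : ℕ} (hQ : Q.PosDef) (X : Matrix (Fin n) (Fin p) ℝ)
    (e : Fin p → ℝ) (d : Fin n → ℝ) (hd : ∀ i, |d i| ≤ |(X *ᵥ e) i|) :
    Real.sqrt ((Q⁻¹ *ᵥ (Xᵀ *ᵥ d)) ⬝ᵥ (Q *ᵥ (Q⁻¹ *ᵥ (Xᵀ *ᵥ d))))
      ≤ lamMax (Q⁻¹ * (Xᵀ * X)) * Real.sqrt (e ⬝ᵥ (Q *ᵥ e)) := by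
  have hA : (Xᵀ * X).PosSemidef := by simpa using posSemidef_conjTranspose_mul_self X
  have hr := lamMax_nonneg hQ hA
  set r := lamMax (Q⁻¹ * (Xᵀ * X))
  have hX (w : Fin p → ℝ) : (X *ᵥ w) ⬝ᵥ (X *ᵥ w) ≤ r * (w ⬝ᵥ (Q *ᵥ w)) := by
    refine le_trans (le_of_eq ?_) (dotProduct_mulVec_le_lamMax_mul hQ hA.1 w)
    rw [← mulVec_mulVec, dotProduct_mulVec w, vecMul_transpose]
  set v := Q⁻¹ *ᵥ (Xᵀ *ᵥ d) with hv
  have hQv : Q *ᵥ v = Xᵀ *ᵥ d := by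
    rw [hv, mulVec_mulVec, mul_nonsing_inv _ ((isUnit_iff_isUnit_det _).1 hQ.isUnit), one_mulVec]
  have hvv : v ⬝ᵥ (Q *ᵥ v) = (X *ᵥ v) ⬝ᵥ d := by
    rw [hQv, dotProduct_mulVec, vecMul_transpose]
  have hdd : d ⬝ᵥ d ≤ (X *ᵥ e) ⬝ᵥ (X *ᵥ e) :=
    Finset.sum_le_sum fun i _ => abs_le_iff_mul_self_le.1 (hd i)
  have hcs : ((X *ᵥ v) ⬝ᵥ d) ^ 2 ≤ ((X *ᵥ v) ⬝ᵥ (X *ᵥ v)) * (d ⬝ᵥ d) := by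
    simpa [dotProduct, sq] using Finset.sum_mul_sq_le_sq_mul_sq Finset.univ (X *ᵥ v) d
  have hqv : 0 ≤ v ⬝ᵥ (Q *ᵥ v) := hQ.posSemidef.dotProduct_mulVec_nonneg v
  have hqe : 0 ≤ e ⬝ᵥ (Q *ᵥ e) := hQ.posSemidef.dotProduct_mulVec_nonneg e
  rw [← hvv] at hcs
  have hle : v ⬝ᵥ (Q *ᵥ v) ≤ r ^ 2 * (e ⬝ᵥ (Q *ᵥ e)) := by
    have hdd0 : 0 ≤ d ⬝ᵥ d := Finset.sum_nonneg fun i _ => mul_self_nonneg _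
    have h₁ : (v ⬝ᵥ (Q *ᵥ v)) * (v ⬝ᵥ (Q *ᵥ v))
        ≤ (v ⬝ᵥ (Q *ᵥ v)) * (r ^ 2 * (e ⬝ᵥ (Q *ᵥ e))) := by
      calc _ ≤ ((X *ᵥ v) ⬝ᵥ (X *ᵥ v)) * (d ⬝ᵥ d) := by rwa [← sq]
        _ ≤ (r * (v ⬝ᵥ (Q *ᵥ v))) * (r * (e ⬝ᵥ (Q *ᵥ e))) :=
          mul_le_mul (hX v) (hdd.trans (hX e)) hdd0 (by positivity)
        _ = _ := by ring
    rcases hqv.eq_or_lt with h | h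
    · rw [← h]; positivity
    · exact le_of_mul_le_mul_left h₁ h
  calc _ ≤ Real.sqrt (r ^ 2 * (e ⬝ᵥ (Q *ᵥ e))) := Real.sqrt_le_sqrt hle
    _ = _ := by rw [Real.sqrt_mul (sq_nonneg r), Real.sqrt_sq hr]

/-- Banach's fixed point theorem in the norm induced by a positive definite matrix. -/
lemma exists_fixedPoint_of_contracting_posDef (hQ : Q.PosDef) {r : ℝ} (hr0 : 0 ≤ r) (hr1 : r < 1)
    (T : (Fin p → ℝ) → (Fin p → ℝ))
    (hT : ∀ m m', Real.sqrt ((T m - T m') ⬝ᵥ (Q *ᵥ (T m - T m')))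
      ≤ r * Real.sqrt ((m - m') ⬝ᵥ (Q *ᵥ (m - m')))) :
    ∃ mstar, T mstar = mstar ∧ ∀ m', T m' = m' → m' = mstar := by
  obtain ⟨L, hL, rfl⟩ := hQ.exists_isUnit_transpose_mul_self
  have hdet : IsUnit L.det := (isUnit_iff_isUnit_det _).1 hL
  let φ : (Fin p → ℝ) → EuclideanSpace ℝ (Fin p) := fun v => WithLp.toLp 2 (L *ᵥ v)
  let ψ : EuclideanSpace ℝ (Fin p) → (Fin p → ℝ) := fun w => L⁻¹ *ᵥ w.ofLp
  have hφψ (w) : φ (ψ w) = w := by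
    simp [φ, ψ, mulVec_mulVec, mul_nonsing_inv _ hdet]
  have hψφ (v) : ψ (φ v) = v := by
    simp [φ, ψ, mulVec_mulVec, nonsing_inv_mul _ hdet]
  have hdist (v w) : dist (φ v) (φ w) = Real.sqrt ((v - w) ⬝ᵥ ((Lᵀ * L) *ᵥ (v - w))) := by
    rw [dist_eq_norm, EuclideanSpace.norm_eq, ← mulVec_mulVec, dotProduct_mulVec, vecMul_transpose]
    simp [φ, dotProduct, mulVec_sub, sq]
  have hc : ContractingWith ⟨r, hr0⟩ fun w => φ (T (ψ w)) := by
    refine ⟨hr1, LipschitzWith.of_dist_le_mul fun w w' => ?_⟩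
    rw [hdist]
    refine (hT _ _).trans_eq ?_
    rw [← hdist, hφψ, hφψ]
    rfl
  refine ⟨ψ hc.fixedPoint, ?_, fun m' hm' => ?_⟩
  · rw [← hψφ (T _)]
    exact congrArg ψ hc.fixedPoint_isFixedPt
  · have h : Function.IsFixedPt (fun w => φ (T (ψ w))) (φ m') := by
      simp [Function.IsFixedPt, hψφ, hm']
    rw [← hc.fixedPoint_unique h, hψφ]

end PosDef

/-- Global exponential convergence of CAVI for Bayesian probit regression
(Proposition 2, restated in terms of the variational means): the mean-update map `T`
is a contraction with rate `r = λ_max((Q₀+XᵀX)⁻¹XᵀX) < 1` in the norm induced by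
`Q = Q₀ + XᵀX`, hence has a unique fixed point towards which the iterates converge
globally exponentially fast at rate `r`. -/
theorem probit_cavi_global_convergence {n p : ℕ}
    (X : Matrix (Fin n) (Fin p) ℝ) (y : Fin n → ℝ) (hy : ∀ i, y i = 0 ∨ y i = 1)
    (Q₀ : Matrix (Fin p) (Fin p) ℝ) (hQ₀ : Q₀.PosDef) (m₀ : Fin p → ℝ)
    (g : Fin n → ℝ → ℝ)
    (hg : ∀ i t, g i t = t + (2 * y i - 1) * (stdNormalPdf t / stdNormalCdf ((2 * y i - 1) * t)))
    (T : (Fin p → ℝ) → (Fin p → ℝ))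
    (hT : ∀ m, T m = (Q₀ + Xᵀ * X)⁻¹ *ᵥ
      (Q₀ *ᵥ m₀ + ∑ i, g i ((X *ᵥ m) i) • fun j => X i j))
    (r : ℝ) (hr : r = lamMax ((Q₀ + Xᵀ * X)⁻¹ * (Xᵀ * X))) :
    r < 1 ∧
    (∀ m m' : Fin p → ℝ,
      Real.sqrt ((T m - T m') ⬝ᵥ ((Q₀ + Xᵀ * X) *ᵥ (T m - T m')))
        ≤ r * Real.sqrt ((m - m') ⬝ᵥ ((Q₀ + Xᵀ * X) *ᵥ (m - m')))) ∧
    ∃ mstar : Fin p → ℝ, T mstar = mstar ∧ (∀ m', T m' = m' → m' = mstar) ∧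
      ∀ m : ℕ → (Fin p → ℝ), (∀ k, m (k + 1) = T (m k)) →
        ∀ k, Real.sqrt ((m k - mstar) ⬝ᵥ ((Q₀ + Xᵀ * X) *ᵥ (m k - mstar)))
          ≤ r ^ k * Real.sqrt ((m 0 - mstar) ⬝ᵥ ((Q₀ + Xᵀ * X) *ᵥ (m 0 - mstar))) := by
  have hA : (Xᵀ * X).PosSemidef := by simpa using posSemidef_conjTranspose_mul_self X
  have hQ : (Q₀ + Xᵀ * X).PosDef := hQ₀.add_posSemidef hA
  have hr0 : 0 ≤ r := hr ▸ lamMax_nonneg hQ hA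
  have hr1 : r < 1 := hr ▸ lamMax_add_inv_mul_lt_one hQ₀ hA
  have hglip (i : Fin n) (s t : ℝ) : |g i s - g i t| ≤ |s - t| := by
    rcases hy i with h | h
    · have e (u : ℝ) : g i u = -truncatedMean (-u) := by
        rw [hg, h, truncatedMean, stdNormalPdf_neg]
        norm_num
        ring
      have := abs_truncatedMean_sub_le (-t) (-s)
      rw [e, e]
      ring_nf at this ⊢
      exact this
    · have e (u : ℝ) : g i u = truncatedMean u := by
        rw [hg, h, truncatedMean]
        norm_num
      rw [e, e]
      exact abs_truncatedMean_sub_le s t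
  have hcontr (m m' : Fin p → ℝ) :
      Real.sqrt ((T m - T m') ⬝ᵥ ((Q₀ + Xᵀ * X) *ᵥ (T m - T m')))
        ≤ r * Real.sqrt ((m - m') ⬝ᵥ ((Q₀ + Xᵀ * X) *ᵥ (m - m'))) := by
    have hsum (f : Fin n → ℝ) : ∑ i, f i • (fun j => X i j) = Xᵀ *ᵥ f := by
      ext j
      simp [mulVec, dotProduct, Finset.sum_apply, mul_comm]
    have hTd : T m - T m' = (Q₀ + Xᵀ * X)⁻¹ *ᵥ
        (Xᵀ *ᵥ fun i => g i ((X *ᵥ m) i) - g i ((X *ᵥ m') i)) := by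
      rw [hT, hT, hsum fun i => g i ((X *ᵥ m) i), hsum fun i => g i ((X *ᵥ m') i), ← mulVec_sub,
        add_sub_add_left_eq_sub, ← mulVec_sub]
      rfl
    rw [hTd, hr]
    refine sqrt_inv_mulVec_transpose_mulVec_le hQ X _ _ fun i => ?_
    rw [mulVec_sub]
    exact hglip i _ _
  obtain ⟨mstar, hfix, huniq⟩ := exists_fixedPoint_of_contracting_posDef hQ hr0 hr1 T hcontr
  refine ⟨hr1, hcontr, mstar, hfix, huniq, fun m hm k => ?_⟩
  induction k with
  | zero => simp
  | succ k ih =>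
    have h := hcontr (m k) mstar
    rw [hfix, ← hm] at h
    rw [pow_succ', mul_assoc]
    exact h.trans (mul_le_mul_of_nonneg_left ih hr0)
end
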